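/- Let n ≥ 1 and let p⃗, s⃗ be n-tuples with 1 ≤ pᵢ, sᵢ ≤ ∞. For every ρ ∈ (0,∞) there exist constants 0 < c ≤ C, independent of f and of r, such that for all r > 0 and all locally integrable f on ℝⁿ: c·‖ y ↦ ‖f·χ_{B(y,r)}‖_{L^{p⃗}} ‖_{L^{s⃗}} ≤ ‖ y ↦ ‖f·χ_{B(y,ρr)}‖_{L^{p⃗}} ‖_{L^{s⃗}} ≤ C·‖ y ↦ ‖f·χ_{B(y,r)}‖_{L^{p⃗}} ‖_{L^{s⃗}}. -/

import Mathlib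

open MeasureTheory ENNReal Filter Topology Set

noncomputable section

namespace MixedAmalgam

/-- `L^p` norm over `ℝ` of an `ℝ≥0∞`-valued function, with the usual
modification (`essSup`) for `p = ∞`. -/
def lpInt (p : ℝ≥0∞) (g : ℝ → ℝ≥0∞) : ℝ≥0∞ :=
  if p = ∞ then essSup g volume else (∫⁻ t, g t ^ p.toReal) ^ (1 / p.toReal)

/-- `ℓ^p` norm over `ℤ` of an `ℝ≥0∞`-valued family, with the usual
modification for `p = ∞`. -/
def lpSum (p : ℝ≥0∞) (g : ℤ → ℝ≥0∞) : ℝ≥0∞ :=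
  if p = ∞ then ⨆ k, g k else (∑' k, g k ^ p.toReal) ^ (1 / p.toReal)

/-- Iterated mixed Lebesgue norm of an `ℝ≥0∞`-valued function on `ℝⁿ`,
taking the `L^{p₁}` norm in the first variable innermost, and the `L^{pₙ}`
norm in the last variable outermost. -/
def mixedE : (n : ℕ) → (Fin n → ℝ≥0∞) → ((Fin n → ℝ) → ℝ≥0∞) → ℝ≥0∞
  | 0, _, g => g Fin.elim0
  | n + 1, p, g =>
    lpInt (p (Fin.last n)) fun t =>
      mixedE n (fun i => p i.castSucc) fun x => g (Fin.snoc x t)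

/-- Mixed-norm Lebesgue norm `‖f‖_{L^{p⃗}}` of a real-valued function on `ℝⁿ`. -/
def mixedLp (n : ℕ) (p : Fin n → ℝ≥0∞) (f : (Fin n → ℝ) → ℝ) : ℝ≥0∞ :=
  mixedE n p fun x => (‖f x‖₊ : ℝ≥0∞)

/-- Iterated mixed `ℓ^{s⃗}` norm of an `ℝ≥0∞`-valued family indexed by `ℤⁿ`. -/
def mixedSeq : (n : ℕ) → (Fin n → ℝ≥0∞) → ((Fin n → ℤ) → ℝ≥0∞) → ℝ≥0∞
  | 0, _, a => a Fin.elim0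
  | n + 1, s, a =>
    lpSum (s (Fin.last n)) fun k =>
      mixedSeq n (fun i => s i.castSucc) fun m => a (Fin.snoc m k)

/-- Open Euclidean ball of center `y` and radius `r` in `ℝⁿ`. -/
def eball (n : ℕ) (y : Fin n → ℝ) (r : ℝ) : Set (Fin n → ℝ) :=
  {x | Real.sqrt (∑ i, (x i - y i) ^ 2) < r}

/-- `Σᵢ 1/pᵢ` as a real number. -/
def invSum (n : ℕ) (p : Fin n → ℝ≥0∞) : ℝ :=
  ∑ i, (1 / p i).toReal

/-- The `(L^{p⃗},L^{s⃗})` amalgam norm computed with balls of radius `r`. -/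
def amalgamNormR (n : ℕ) (p s : Fin n → ℝ≥0∞) (r : ℝ) (f : (Fin n → ℝ) → ℝ) : ℝ≥0∞ :=
  mixedE n s fun y => mixedLp n p ((eball n y r).indicator f)

/-- The amalgam norm `‖f‖_{(L^{p⃗},L^{s⃗})}`. -/
def amalgamNorm (n : ℕ) (p s : Fin n → ℝ≥0∞) (f : (Fin n → ℝ) → ℝ) : ℝ≥0∞ :=
  amalgamNormR n p s 1 f

/-- The amalgam norm `‖f‖_{(L^{p⃗},L^{s⃗})^α}`. -/
def amalgamNormA (n : ℕ) (p s : Fin n → ℝ≥0∞) (α : ℝ≥0∞) (f : (Fin n → ℝ) → ℝ) : ℝ≥0∞ :=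
  ⨆ (r : ℝ) (_ : 0 < r),
    mixedE n s fun y =>
      volume (eball n y r) ^
          ((1 / α).toReal - invSum n p / (n : ℝ) - invSum n s / (n : ℝ)) *
        mixedLp n p ((eball n y r).indicator f)

/-- The amalgam norm `‖·‖_{(L^{p⃗},L^{s⃗})^α}` for `ℝ≥0∞`-valued functions. -/
def amalgamNormAE (n : ℕ) (p s : Fin n → ℝ≥0∞) (α : ℝ≥0∞)
    (g : (Fin n → ℝ) → ℝ≥0∞) : ℝ≥0∞ :=
  ⨆ (r : ℝ) (_ : 0 < r),
    mixedE n s fun y =>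
      volume (eball n y r) ^
          ((1 / α).toReal - invSum n p / (n : ℝ) - invSum n s / (n : ℝ)) *
        mixedE n p ((eball n y r).indicator g)

/-- The cube `Q_{r,k} = r(k + [0,1)ⁿ)`. -/
def qcube (n : ℕ) (r : ℝ) (k : Fin n → ℤ) : Set (Fin n → ℝ) :=
  {x | ∀ i, r * (k i : ℝ) ≤ x i ∧ x i < r * ((k i : ℝ) + 1)}

/-- The discrete amalgam norm `_r‖f‖_{p⃗,s⃗}`. -/
def discNormR (n : ℕ) (p s : Fin n → ℝ≥0∞) (r : ℝ) (f : (Fin n → ℝ) → ℝ) : ℝ≥0∞ :=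
  mixedSeq n s fun k => mixedLp n p ((qcube n r k).indicator f)

/-- The discrete amalgam norm `‖f‖_{p⃗,s⃗} = _1‖f‖_{p⃗,s⃗}`. -/
def discNorm (n : ℕ) (p s : Fin n → ℝ≥0∞) (f : (Fin n → ℝ) → ℝ) : ℝ≥0∞ :=
  discNormR n p s 1 f

/-- The discrete amalgam norm
`‖f‖_{p⃗,s⃗,α} = sup_{r>0} r^{n/α - Σᵢ 1/pᵢ} · _r‖f‖_{p⃗,s⃗}`. -/
def discNormA (n : ℕ) (p s : Fin n → ℝ≥0∞) (α : ℝ≥0∞) (f : (Fin n → ℝ) → ℝ) : ℝ≥0∞ :=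
  ⨆ (r : ℝ) (_ : 0 < r),
    ENNReal.ofReal (r ^ ((n : ℝ) * (1 / α).toReal - invSum n p)) * discNormR n p s r f

/-- Membership in `(L^{p⃗},L^{s⃗})^α(ℝⁿ)` (continuous form). -/
def memA (n : ℕ) (p s : Fin n → ℝ≥0∞) (α : ℝ≥0∞) (f : (Fin n → ℝ) → ℝ) : Prop :=
  LocallyIntegrable f volume ∧ amalgamNormA n p s α f < ∞

/-- Membership in `(L^{p⃗},ℓ^{s⃗})(ℝⁿ)`. -/
def memD (n : ℕ) (p s : Fin n → ℝ≥0∞) (f : (Fin n → ℝ) → ℝ) : Prop :=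
  LocallyIntegrable f volume ∧ discNorm n p s f < ∞

/-- Membership in `(L^{p⃗},ℓ^{s⃗})^α(ℝⁿ)`. -/
def memDA (n : ℕ) (p s : Fin n → ℝ≥0∞) (α : ℝ≥0∞) (f : (Fin n → ℝ) → ℝ) : Prop :=
  LocallyIntegrable f volume ∧ discNormA n p s α f < ∞

/-- The dilation `St_r^{(α)} f = r^{-n/α} f(r⁻¹ ·)`. -/
def dil (n : ℕ) (α : ℝ≥0∞) (r : ℝ) (f : (Fin n → ℝ) → ℝ) : (Fin n → ℝ) → ℝ :=
  fun x => r ^ (-((n : ℝ) * (1 / α).toReal)) * f (r⁻¹ • x)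

/-- A block decomposition `f = Σ_j c_j St_{r_j}^{(α')} f_j` converging in `L¹_loc`. -/
structure BlockDecomp (n : ℕ) (p' s' : Fin n → ℝ≥0∞) (α' : ℝ≥0∞) (f : (Fin n → ℝ) → ℝ)
    (c : ℕ → ℝ) (rr : ℕ → ℝ) (g : ℕ → (Fin n → ℝ) → ℝ) : Prop where
  csummable : Summable fun j => |c j|
  rpos : ∀ j, 0 < rr j
  gloc : ∀ j, LocallyIntegrable (g j) volume
  gnorm : ∀ j, discNorm n p' s' (g j) ≤ 1
  conv : ∀ K : Set (Fin n → ℝ), IsCompact K →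
    Tendsto (fun J : ℕ =>
        ∫⁻ x in K,
          (‖f x - ∑ j ∈ Finset.range J, c j * dil n α' (rr j) (g j) x‖₊ : ℝ≥0∞))
      atTop (𝓝 0)

/-- Membership in the block space `H(p⃗',s⃗',α')`. -/
def memH (n : ℕ) (p' s' : Fin n → ℝ≥0∞) (α' : ℝ≥0∞) (f : (Fin n → ℝ) → ℝ) : Prop :=
  LocallyIntegrable f volume ∧ ∃ c rr g, BlockDecomp n p' s' α' f c rr g

/-- The norm of the block space `H(p⃗',s⃗',α')`. -/
def hNorm (n : ℕ) (p' s' : Fin n → ℝ≥0∞) (α' : ℝ≥0∞) (f : (Fin n → ℝ) → ℝ) : ℝ≥0∞ :=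
  ⨅ (c : ℕ → ℝ) (rr : ℕ → ℝ) (g : ℕ → (Fin n → ℝ) → ℝ)
    (_ : BlockDecomp n p' s' α' f c rr g), ENNReal.ofReal (∑' j, |c j|)

/-- The fractional integral operator `I_γ`. -/
def fracInt (n : ℕ) (γ : ℝ) (f : (Fin n → ℝ) → ℝ) : (Fin n → ℝ) → ℝ :=
  fun x => ∫ y, f y / Real.sqrt (∑ i, (x i - y i) ^ 2) ^ ((n : ℝ) - γ)

/-- The fractional maximal operator `M_γ`. -/
def fracMax (n : ℕ) (γ : ℝ) (f : (Fin n → ℝ) → ℝ) : (Fin n → ℝ) → ℝ≥0∞ :=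
  fun x => ⨆ (y : Fin n → ℝ) (r : ℝ) (_ : 0 < r) (_ : x ∈ eball n y r),
    volume (eball n y r) ^ (γ / (n : ℝ) - 1) * ∫⁻ z in eball n y r, (‖f z‖₊ : ℝ≥0∞)

/-- The commutator `[b, I_γ] f`. -/
def commFracInt (n : ℕ) (γ : ℝ) (b f : (Fin n → ℝ) → ℝ) : (Fin n → ℝ) → ℝ :=
  fun x => ∫ y, (b x - b y) * f y / Real.sqrt (∑ i, (x i - y i) ^ 2) ^ ((n : ℝ) - γ)

/-- The mean value `b_B` of `b` over the ball `B(y,r)`. -/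
def ballAvg (n : ℕ) (b : (Fin n → ℝ) → ℝ) (y : Fin n → ℝ) (r : ℝ) : ℝ :=
  (volume (eball n y r)).toReal⁻¹ * ∫ x in eball n y r, b x

/-- The `BMO` norm `sup_B (1/|B|) ∫_B |b - b_B|`. -/
def bmoNorm (n : ℕ) (b : (Fin n → ℝ) → ℝ) : ℝ≥0∞ :=
  ⨆ (y : Fin n → ℝ) (r : ℝ) (_ : 0 < r),
    ENNReal.ofReal
      ((volume (eball n y r)).toReal⁻¹ * ∫ x in eball n y r, |b x - ballAvg n b y r|)

lemma lpInt_mono (p : ℝ≥0∞) {g h : ℝ → ℝ≥0∞} (H : ∀ t, g t ≤ h t) : lpInt p g ≤ lpInt p h := by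
  unfold lpInt
  split_ifs with hp
  · exact essSup_mono_ae (Eventually.of_forall H)
  · gcongr with t
    exact H t

lemma lpInt_congr (p : ℝ≥0∞) {g h : ℝ → ℝ≥0∞} (H : g =ᵐ[volume] h) : lpInt p g = lpInt p h := by
  unfold lpInt
  split_ifs with hp
  · exact essSup_congr_ae H
  · congr 1
    apply lintegral_congr_ae
    filter_upwards [H] with t ht
    rw [ht]

lemma lpInt_zero (p : ℝ≥0∞) (hp : 1 ≤ p) : lpInt p (fun _ => 0) = 0 := by
  unfold lpInt
  split_ifs with h
  · exact essSup_const_bot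
  · have : 0 < p.toReal := ENNReal.toReal_pos (by rintro rfl; simp at hp) h
    simp [ENNReal.zero_rpow_of_pos this, this]

lemma lpInt_add_le (p : ℝ≥0∞) (hp : 1 ≤ p) {g h : ℝ → ℝ≥0∞} (hg : Measurable g)
    (hh : Measurable h) : lpInt p (fun t => g t + h t) ≤ lpInt p g + lpInt p h := by
  unfold lpInt
  split_ifs with h1
  · exact ENNReal.essSup_add_le g h
  · have : 1 ≤ p.toReal := by
      rw [← ENNReal.toReal_one]
      exact ENNReal.toReal_mono h1 hp
    exact ENNReal.lintegral_Lp_add_le hg.aemeasurable hh.aemeasurable this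

lemma lpInt_translate (p : ℝ≥0∞) (g : ℝ → ℝ≥0∞) (v : ℝ) :
    lpInt p (fun t => g (t + v)) = lpInt p g := by
  unfold lpInt
  split_ifs with h1
  · have h2 : essSup g (Measure.map (MeasurableEquiv.addRight v) volume) =
        essSup (g ∘ MeasurableEquiv.addRight v) volume :=
      (MeasurableEquiv.addRight v).measurableEmbedding.essSup_map_measure
    have h3 : Measure.map (MeasurableEquiv.addRight v) (volume : Measure ℝ) = volume :=
      map_add_right_eq_self volume v
    rw [h3] at h2
    exact h2.symm
  · rw [lintegral_add_right_eq_self (fun t => g t ^ p.toReal) v]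

lemma lpInt_measurable {α : Type} [MeasurableSpace α] (p : ℝ≥0∞) {g : α × ℝ → ℝ≥0∞}
    (hg : Measurable g) : Measurable fun a => lpInt p fun t => g (a, t) := by
  unfold lpInt
  split_ifs with h1
  · apply measurable_of_Ioi
    intro c
    have : (fun a => essSup (fun t => g (a, t)) volume) ⁻¹' Ioi c =
        {a | 0 < volume (Prod.mk a ⁻¹' (g ⁻¹' Ioi c))} := by
      ext a
      simp only [mem_preimage, mem_Ioi, mem_ofPred_eq]
      rw [← not_le, pos_iff_ne_zero, Ne, not_iff_not]
      constructor
      · intro h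
        have := ENNReal.ae_le_essSup (μ := volume) (fun t => g (a, t))
        rw [← nonpos_iff_eq_zero]
        rw [ae_iff] at this
        rw [← this]
        apply measure_mono
        intro t ht
        simp only [mem_preimage, mem_Ioi, mem_ofPred_eq, not_le] at ht ⊢
        exact lt_of_le_of_lt h ht
      · intro h
        refine essSup_le_of_ae_le c ?_
        rw [Filter.EventuallyLE, ae_iff]
        rw [← h]
        congr 1
        ext t
        simp
    rw [this]
    exact (measurable_measure_prodMk_left (hg measurableSet_Ioi)) measurableSet_Ioi
  · exact (Measurable.lintegral_prod_right' (hg.pow_const _)).pow_const _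

lemma measurable_snoc (n : ℕ) :
    Measurable fun q : (Fin n → ℝ) × ℝ => (Fin.snoc q.1 q.2 : Fin (n + 1) → ℝ) := by
  rw [measurable_pi_iff]
  intro i
  refine Fin.lastCases ?_ (fun j => ?_) i
  · simpa using measurable_snd
  · simp only [Fin.snoc_castSucc]
    exact (measurable_pi_apply j).comp measurable_fst

lemma mixedE_mono (n : ℕ) (p : Fin n → ℝ≥0∞) {g h : (Fin n → ℝ) → ℝ≥0∞}
    (H : ∀ x, g x ≤ h x) : mixedE n p g ≤ mixedE n p h := by
  induction n with
  | zero => exact H _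
  | succ n ih => exact lpInt_mono _ fun t => ih _ fun x => H _

lemma mixedE_zero (n : ℕ) (p : Fin n → ℝ≥0∞) (hp : ∀ i, 1 ≤ p i) :
    mixedE n p (fun _ => 0) = 0 := by
  induction n with
  | zero => rfl
  | succ n ih =>
    simp only [mixedE]
    rw [ih _ fun i => hp _]
    exact lpInt_zero _ (hp _)

lemma mixedE_measurable (n : ℕ) (p : Fin n → ℝ≥0∞) {α : Type} [MeasurableSpace α]
    {g : α → (Fin n → ℝ) → ℝ≥0∞} (hg : Measurable fun q : α × (Fin n → ℝ) => g q.1 q.2) :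
    Measurable fun a => mixedE n p (g a) := by
  induction n generalizing α with
  | zero => exact hg.comp (measurable_id.prodMk measurable_const)
  | succ n ih =>
    simp only [mixedE]
    apply lpInt_measurable (p (Fin.last n))
      (g := fun q : α × ℝ => mixedE n (fun i => p i.castSucc) fun x => g q.1 (Fin.snoc x q.2))
    apply ih (g := fun (q : α × ℝ) x => g q.1 (Fin.snoc x q.2))
    exact hg.comp ((measurable_fst.comp measurable_fst).prodMk
      ((measurable_snoc n).comp (measurable_snd.prodMk (measurable_snd.comp measurable_fst))))

lemma mixedE_add_le (n : ℕ) (p : Fin n → ℝ≥0∞) (hp : ∀ i, 1 ≤ p i)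
    {g h : (Fin n → ℝ) → ℝ≥0∞} (hg : Measurable g) (hh : Measurable h) :
    mixedE n p (fun x => g x + h x) ≤ mixedE n p g + mixedE n p h := by
  induction n with
  | zero => exact le_rfl
  | succ n ih =>
    have key : ∀ {g : (Fin (n+1) → ℝ) → ℝ≥0∞}, Measurable g →
        Measurable fun q : ℝ × (Fin n → ℝ) => g (Fin.snoc q.2 q.1) := fun hg =>
      hg.comp ((measurable_snoc n).comp (measurable_snd.prodMk measurable_fst))
    have sl : ∀ {g : (Fin (n+1) → ℝ) → ℝ≥0∞}, Measurable g → ∀ t : ℝ,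
        Measurable fun x : (Fin n → ℝ) => g (Fin.snoc x t) := fun hg t =>
      hg.comp ((measurable_snoc n).comp (measurable_id.prodMk measurable_const))
    simp only [mixedE]
    refine (lpInt_mono _ fun t => ih _ (fun i => hp _) (sl hg t) (sl hh t)).trans ?_
    exact lpInt_add_le _ (hp _)
      (mixedE_measurable n _ (g := fun t x => g (Fin.snoc x t)) (key hg))
      (mixedE_measurable n _ (g := fun t x => h (Fin.snoc x t)) (key hh))

lemma mixedE_sum_le (n : ℕ) (p : Fin n → ℝ≥0∞) (hp : ∀ i, 1 ≤ p i) {ι : Type*}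
    (Z : Finset ι) {g : ι → (Fin n → ℝ) → ℝ≥0∞} (hg : ∀ i, Measurable (g i)) :
    mixedE n p (fun x => ∑ i ∈ Z, g i x) ≤ ∑ i ∈ Z, mixedE n p (g i) := by
  classical
  induction Z using Finset.induction_on with
  | empty => simp [mixedE_zero n p hp]
  | insert a Z ha ih =>
    simp only [Finset.sum_insert ha]
    refine (mixedE_add_le n p hp (hg a) (Finset.measurable_fun_sum _ fun i _ => hg i)).trans ?_
    gcongr

lemma mixedE_translate (n : ℕ) (p : Fin n → ℝ≥0∞) (g : (Fin n → ℝ) → ℝ≥0∞) (v : Fin n → ℝ) :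
    mixedE n p (fun x => g (x + v)) = mixedE n p g := by
  induction n with
  | zero => exact congrArg g (Subsingleton.elim _ _)
  | succ n ih =>
    simp only [mixedE]
    have h1 : ∀ (t : ℝ) (x : Fin n → ℝ), (Fin.snoc x t : Fin (n+1) → ℝ) + v =
        Fin.snoc (x + fun i => v i.castSucc) (t + v (Fin.last n)) := by
      intro t x
      ext i
      refine Fin.lastCases ?_ (fun j => ?_) i <;> simp
    simp only [h1]
    rw [← lpInt_translate _ (fun t => mixedE n (fun i => p i.castSucc)
      fun x => g (Fin.snoc x t)) (v (Fin.last n))]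
    congr 1
    ext t
    exact ih _ (fun x => g (Fin.snoc x (t + v (Fin.last n)))) (fun i => v i.castSucc)

lemma mixedE_congr (n : ℕ) (p : Fin n → ℝ≥0∞) {g h : (Fin n → ℝ) → ℝ≥0∞}
    (H : g =ᵐ[volume] h) : mixedE n p g = mixedE n p h := by
  induction n with
  | zero =>
    have : g = h := by
      rw [Filter.EventuallyEq, volume_pi, Measure.pi_of_empty _ Fin.elim0, ae_dirac_eq] at H
      ext x
      rw [Subsingleton.elim x Fin.elim0]
      exact H
    rw [this]
  | succ n ih =>
    simp only [mixedE]
    apply lpInt_congr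
    have mp := (volume_preserving_piFinSuccAbove (fun _ : Fin (n+1) => ℝ) (Fin.last n)).symm
    have h1 := mp.quasiMeasurePreserving.ae H
    have h2 := Measure.ae_ae_of_ae_prod h1
    filter_upwards [h2] with t ht
    apply ih
    filter_upwards [ht] with x hx
    have e : (MeasurableEquiv.piFinSuccAbove (fun _ : Fin (n+1) => ℝ) (Fin.last n)).symm (t, x)
        = Fin.snoc x t := by
      exact Fin.insertNth_last' t x
    rw [e] at hx
    exact hx

lemma exists_cover (n : ℕ) (ρ : ℝ) : ∃ Z : Finset (Fin n → ℝ), ∀ (r : ℝ), 0 < r →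
    ∀ y x : Fin n → ℝ, x ∈ eball n y (ρ * r) → ∃ z ∈ Z, x ∈ eball n (y + r • z) r := by
  classical
  obtain ⟨t, -, tf, ht⟩ := (isCompact_closedBall (0 : EuclideanSpace ℝ (Fin n)) ρ).finite_cover_balls
    (zero_lt_one)
  refine ⟨tf.toFinset.image (fun z => (fun i => z i)), fun r hr y x hx => ?_⟩
  let w : EuclideanSpace ℝ (Fin n) := WithLp.toLp 2 (x - y)
  have hw : ‖w‖ < ρ * r := by
    rw [EuclideanSpace.norm_eq]
    simpa [w, eball] using hx
  have hw2 : r⁻¹ • w ∈ Metric.closedBall (0 : EuclideanSpace ℝ (Fin n)) ρ := by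
    rw [mem_closedBall_zero_iff, norm_smul, Real.norm_of_nonneg (by positivity)]
    rw [inv_mul_le_iff₀ hr]
    linarith
  obtain ⟨z, hz, hz2⟩ := mem_iUnion₂.1 (ht hw2)
  refine ⟨_, Finset.mem_image_of_mem _ (tf.mem_toFinset.2 hz), ?_⟩
  have h3 : ‖w - r • z‖ < r := by
    have : w - r • z = r • (r⁻¹ • w - z) := by
      rw [smul_sub, smul_smul, mul_inv_cancel₀ hr.ne', one_smul]
    rw [this, norm_smul, Real.norm_of_nonneg hr.le]
    rw [Metric.mem_ball, dist_eq_norm] at hz2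
    nlinarith
  rw [EuclideanSpace.norm_eq] at h3
  simpa [w, eball, sub_sub] using h3

lemma amalgam_congr (n : ℕ) (p s : Fin n → ℝ≥0∞) (r : ℝ) {f g : (Fin n → ℝ) → ℝ}
    (H : f =ᵐ[volume] g) : amalgamNormR n p s r f = amalgamNormR n p s r g := by
  unfold amalgamNormR mixedLp
  congr 1
  ext y
  apply mixedE_congr
  filter_upwards [H] with x hx
  simp only [indicator, hx]

lemma amalgam_le (n : ℕ) (p s : Fin n → ℝ≥0∞)
    (hp : ∀ i, 1 ≤ p i) (hs : ∀ i, 1 ≤ s i) (ρ : ℝ) :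
    ∃ C : ℝ≥0∞, 1 ≤ C ∧ C < ∞ ∧ ∀ r : ℝ, 0 < r → ∀ f : (Fin n → ℝ) → ℝ,
      LocallyIntegrable f volume →
      amalgamNormR n p s (ρ * r) f ≤ C * amalgamNormR n p s r f := by
  obtain ⟨Z, hZ⟩ := exists_cover n ρ
  refine ⟨(Z.card : ℝ≥0∞) + 1, le_add_self, by simp [ENNReal.add_lt_top], fun r hr f hf => ?_⟩
  obtain ⟨g, gm, hfg⟩ := hf.aestronglyMeasurable
  rw [amalgam_congr n p s _ hfg, amalgam_congr n p s _ hfg]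
  have hm : Measurable fun q : (Fin n → ℝ) × (Fin n → ℝ) =>
      (‖(eball n q.1 r).indicator g q.2‖₊ : ℝ≥0∞) := by
    have hS : MeasurableSet {q : (Fin n → ℝ) × (Fin n → ℝ) | q.2 ∈ eball n q.1 r} := by
      have h0 : Measurable fun q : (Fin n → ℝ) × (Fin n → ℝ) =>
          Real.sqrt (∑ i, (q.2 i - q.1 i) ^ 2) := by fun_prop
      exact measurableSet_lt h0 (measurable_const (a := r))
    have := ((gm.measurable.comp measurable_snd).indicator hS).nnnorm.coe_nnreal_ennreal
    have e : (fun q : (Fin n → ℝ) × (Fin n → ℝ) =>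
      (‖(eball n q.1 r).indicator g q.2‖₊ : ℝ≥0∞)) = _ := funext fun q => by
        have : (eball n q.1 r).indicator g q.2 =
          {q : (Fin n → ℝ) × (Fin n → ℝ) | q.2 ∈ eball n q.1 r}.indicator (g ∘ Prod.snd) q := by
            by_cases hq : q.2 ∈ eball n q.1 r
            · rw [indicator_of_mem hq, indicator_of_mem (by exact hq)]; rfl
            · rw [indicator_of_notMem hq, indicator_of_notMem (by exact hq)]
        rw [this]
    rw [e]
    exact this
  have hm1 : ∀ w : Fin n → ℝ,
      Measurable fun x => (‖(eball n w r).indicator g x‖₊ : ℝ≥0∞) := fun w => by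
    have h0 : Measurable fun x : Fin n → ℝ => (w, x) := measurable_prodMk_left
    have h1 := hm.comp h0
    simp only [Function.comp_def] at h1
    exact h1
  have hF : Measurable fun y => mixedLp n p ((eball n y r).indicator g) :=
    mixedE_measurable n p hm
  have step : ∀ y, mixedLp n p ((eball n y (ρ * r)).indicator g) ≤
      ∑ z ∈ Z, mixedLp n p ((eball n (y + r • z) r).indicator g) := by
    intro y
    refine (mixedE_mono n p ?_).trans (mixedE_sum_le n p hp Z
      (g := fun z x => (‖(eball n (y + r • z) r).indicator g x‖₊ : ℝ≥0∞)) fun z => ?_)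
    · intro x
      by_cases hx : x ∈ eball n y (ρ * r)
      · obtain ⟨z, hz, hxz⟩ := hZ r hr y x hx
        refine le_trans ?_ (Finset.single_le_sum (fun _ _ => zero_le) hz)
        rw [indicator_of_mem hx, indicator_of_mem hxz]
      · simp [indicator_of_notMem hx]
    · exact hm1 _
  have hG : ∀ z : Fin n → ℝ,
      Measurable fun y => mixedLp n p ((eball n (y + r • z) r).indicator g) := by
    intro z
    have h0 : Measurable fun y : Fin n → ℝ => y + r • z := measurable_id.add_const _
    exact hF.comp h0
  have hsum : amalgamNormR n p s (ρ * r) g ≤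
      ∑ z ∈ Z, mixedE n s (fun y => mixedLp n p ((eball n (y + r • z) r).indicator g)) := by
    have h1 := mixedE_mono n s step
    have h2 := mixedE_sum_le n s hs Z hG
    unfold amalgamNormR
    exact h1.trans h2
  calc amalgamNormR n p s (ρ * r) g
      ≤ ∑ z ∈ Z, mixedE n s (fun y => mixedLp n p ((eball n (y + r • z) r).indicator g)) :=
        hsum
    _ = ∑ z ∈ Z, amalgamNormR n p s r g := Finset.sum_congr rfl fun z _ =>
        mixedE_translate n s (fun y => mixedLp n p ((eball n y r).indicator g)) (r • z)
    _ = Z.card * amalgamNormR n p s r g := by rw [Finset.sum_const, nsmul_eq_mul]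
    _ ≤ _ := by gcongr; exact le_self_add

/-- For every `ρ > 0` the amalgam norms computed with balls of
radius `r` and `ρr` are equivalent, uniformly in `r` and `f`. -/
theorem statement4 (n : ℕ) (hn : 1 ≤ n) (p s : Fin n → ℝ≥0∞)
    (hp : ∀ i, 1 ≤ p i) (hs : ∀ i, 1 ≤ s i) :
    ∀ ρ : ℝ, 0 < ρ →
      ∃ c C : ℝ≥0∞, 0 < c ∧ c ≤ C ∧ C < ∞ ∧
        ∀ r : ℝ, 0 < r → ∀ f : (Fin n → ℝ) → ℝ, LocallyIntegrable f volume →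
          c * amalgamNormR n p s r f ≤ amalgamNormR n p s (ρ * r) f ∧
          amalgamNormR n p s (ρ * r) f ≤ C * amalgamNormR n p s r f := by
  intro ρ hρ
  obtain ⟨C, hC1, hC, h⟩ := amalgam_le n p s hp hs ρ
  obtain ⟨D, hD1, hD, h'⟩ := amalgam_le n p s hp hs ρ⁻¹
  refine ⟨D⁻¹, C, ENNReal.inv_pos.2 hD.ne, (ENNReal.inv_le_one.2 hD1).trans hC1, hC,
    fun r hr f hf => ⟨?_, h r hr f hf⟩⟩
  have := h' (ρ * r) (by positivity) f hf
  rw [inv_mul_cancel_left₀ hρ.ne'] at this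
  rwa [mul_comm, ← div_eq_mul_inv,
    ENNReal.div_le_iff (zero_lt_one.trans_le hD1).ne' hD.ne, mul_comm]

end MixedAmalgam

end
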